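/- If a tree sequent Γ ⇒^T Δ is provable in TEFL, then its formulaic translation ⟦Γ ⇒^T Δ⟧_i at the root i of T is provable in the Hilbert system HEFL. -/

import Mathlib

set_option autoImplicit false

/-- Formulas of Epistemic Logic of Friendship:
    nominals, propositional variables, ⊥, →, @ₙ, F, □. -/
inductive Form : Type
  | nom : ℕ → Form
  | pv  : ℕ → Form
  | bot : Form
  | imp : Form → Form → Form
  | atf : ℕ → Form → Form
  | fr  : Form → Form
  | box : Form → Form
  deriving DecidableEq

def Form.neg (φ : Form) : Form := Form.imp φ Form.bot
def Form.top : Form := Form.neg Form.bot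
def Form.and (φ ψ : Form) : Form := Form.neg (Form.imp φ (Form.neg ψ))
def Form.or (φ ψ : Form) : Form := Form.imp (Form.neg φ) ψ
def Form.iff (φ ψ : Form) : Form := Form.and (Form.imp φ ψ) (Form.imp ψ φ)
/-- ⟨F⟩φ := ¬F¬φ -/
def Form.diaF (φ : Form) : Form := Form.neg (Form.fr (Form.neg φ))

/-- `Form.sub m k φ` is φ[m/k] : substitute nominal k by nominal m. -/
def Form.sub (m k : ℕ) : Form → Form
  | .nom n => if n = k then .nom m else .nom n
  | .pv p => .pv p
  | .bot => .bot
  | .imp φ ψ => .imp (Form.sub m k φ) (Form.sub m k ψ)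
  | .atf n φ => .atf (if n = k then m else n) (Form.sub m k φ)
  | .fr φ => .fr (Form.sub m k φ)
  | .box φ => .box (Form.sub m k φ)

/-- nominals occurring in a formula -/
def Form.noms : Form → Finset ℕ
  | .nom n => {n}
  | .pv _ => ∅
  | .bot => ∅
  | .imp φ ψ => Form.noms φ ∪ Form.noms ψ
  | .atf n φ => insert n (Form.noms φ)
  | .fr φ => Form.noms φ
  | .box φ => Form.noms φ

/-- Labels: natural numbers are labels, and `child α n i` is the label α·ₙi,
    an n-child of α. -/
inductive Label : Type
  | root : ℕ → Label
  | child : Label → ℕ → ℕ → Label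
  deriving DecidableEq

/-- nominals occurring in a label -/
def Label.noms : Label → Finset ℕ
  | .root _ => ∅
  | .child α n _ => insert n (Label.noms α)

/-- natural numbers occurring in a label -/
def Label.nats : Label → Finset ℕ
  | .root j => {j}
  | .child α _ i => insert i (Label.nats α)

/-- apply a nominal renaming to (the edge nominals of) a label -/
def Label.subst (σn : ℕ → ℕ) : Label → Label
  | .root j => .root j
  | .child α n i => .child (Label.subst σn α) (σn n) i

/-- A labelled formula (α, φ) stands for α:φ, where φ is intended @-prefixed. -/
abbrev LForm : Type := Label × Form

/-- A finite tree of labels: a unique natural-number root, closed under parents. -/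
def IsTree (T : Finset Label) : Prop :=
  (∃! j : ℕ, Label.root j ∈ T) ∧ ∀ α n i, Label.child α n i ∈ T → α ∈ T

/-- A (possibly infinite) tree of labels. -/
def SetIsTree (T : Set Label) : Prop :=
  (∃! j : ℕ, Label.root j ∈ T) ∧ ∀ α n i, Label.child α n i ∈ T → α ∈ T

/-- A frame: states, agents, accessibility Rₐ and friendship ≍_w. -/
structure Frame (W A : Type) : Type where
  wne : Nonempty W
  ane : Nonempty A
  R : A → W → W → Prop
  friend : W → A → A → Prop

/-- A model: a frame with a valuation; nominals denote unique agents via `Vn`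
    (this builds in V(n) = W × {n̲}). -/
structure Model (W A : Type) extends Frame W A where
  Vp : ℕ → W → A → Prop
  Vn : ℕ → A

section Semantics
variable {W A : Type}

/-- Two-dimensional satisfaction M,(w,a) ⊨ φ. -/
def Sat (M : Model W A) : W → A → Form → Prop
  | _, a, .nom n => M.Vn n = a
  | w, a, .pv p => M.Vp p w a
  | _, _, .bot => False
  | w, a, .imp φ ψ => Sat M w a φ → Sat M w a ψ
  | w, _, .atf n φ => Sat M w (M.Vn n) φ
  | w, a, .fr φ => ∀ b, M.friend w a b → Sat M w b φ
  | w, a, .box φ => ∀ v, M.R a w v → Sat M v a φ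

/-- f is a T-assignment: it respects the n-child edges of T. -/
def IsAssign (M : Model W A) (T : Finset Label) (f : Label → W) : Prop :=
  ∀ α n i, Label.child α n i ∈ T → M.R (M.Vn n) (f α) (f (Label.child α n i))

/-- Truth of a labelled formula α:@ₙφ at (M,f); for @-prefixed formulas
    the agent coordinate is irrelevant. -/
def LSat (M : Model W A) (f : Label → W) (l : LForm) : Prop :=
  ∀ a : A, Sat M (f l.1) a l.2

/-- Truth of a tree sequent Γ ⇒ᵀ Δ at (M,f). -/
def SeqTrue (M : Model W A) (f : Label → W) (Γ Δ : Finset LForm) : Prop :=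
  (∀ l ∈ Γ, LSat M f l) → ∃ l ∈ Δ, LSat M f l

end Semantics

/-- Nominal m is fresh in the sequent Γ ⇒ᵀ Δ. -/
def FreshNom (m : ℕ) (T : Finset Label) (Γ Δ : Finset LForm) : Prop :=
  (∀ β ∈ T, m ∉ Label.noms β) ∧
    (∀ l ∈ Γ, m ∉ Label.noms l.1 ∧ m ∉ Form.noms l.2) ∧
    (∀ l ∈ Δ, m ∉ Label.noms l.1 ∧ m ∉ Form.noms l.2)

/-- Natural number i is fresh in the sequent Γ ⇒ᵀ Δ. -/
def FreshNat (i : ℕ) (T : Finset Label) (Γ Δ : Finset LForm) : Prop :=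
  (∀ β ∈ T, i ∉ Label.nats β) ∧
    (∀ l ∈ Γ, i ∉ Label.nats l.1) ∧ (∀ l ∈ Δ, i ∉ Label.nats l.1)

/-- Tree-sequent derivations of height ≤ h.  `Deriv true` is TEFL (with Cut),
    `Deriv false` is TEFL⁻ (without Cut). -/
inductive Deriv (c : Bool) : Finset Label → Finset LForm → Finset LForm → ℕ → Prop
  | bot {T : Finset Label} {Γ Δ : Finset LForm} (α : Label) (n : ℕ) :
      Deriv c T (insert (α, Form.atf n Form.bot) Γ) Δ 0
  | id {T : Finset Label} {Γ Δ : Finset LForm} (α : Label) (n : ℕ) (φ : Form) :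
      Deriv c T (insert (α, Form.atf n φ) Γ) (insert (α, Form.atf n φ) Δ) 0
  | rep1 {T : Finset Label} {Γ Δ : Finset LForm} {h : ℕ} (α : Label) (n m k : ℕ) (φ : Form) :
      Deriv c T (insert (α, Form.atf n (Form.nom m)) (insert (α, Form.sub n k φ) Γ)) Δ h →
      Deriv c T (insert (α, Form.atf n (Form.nom m)) (insert (α, Form.sub m k φ) Γ)) Δ (h+1)
  | rep2 {T : Finset Label} {Γ Δ : Finset LForm} {h : ℕ} (α : Label) (n m k : ℕ) (φ : Form) :
      Deriv c T (insert (α, Form.atf n (Form.nom m)) (insert (α, Form.sub m k φ) Γ)) Δ h →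
      Deriv c T (insert (α, Form.atf n (Form.nom m)) (insert (α, Form.sub n k φ) Γ)) Δ (h+1)
  | refl {T : Finset Label} {Γ Δ : Finset LForm} {h : ℕ} (α : Label) (n : ℕ) :
      α ∈ T →
      Deriv c T (insert (α, Form.atf n (Form.nom n)) Γ) Δ h →
      Deriv c T Γ Δ (h+1)
  | rigid {T : Finset Label} {Γ Δ : Finset LForm} {h : ℕ} (α β : Label) (n m : ℕ) :
      β ∈ T →
      Deriv c T (insert (β, Form.atf n (Form.nom m)) Γ) Δ h →
      Deriv c T (insert (α, Form.atf n (Form.nom m)) Γ) Δ (h+1)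
  | impR {T : Finset Label} {Γ Δ : Finset LForm} {h : ℕ} (α : Label) (n : ℕ) (φ ψ : Form) :
      Deriv c T (insert (α, Form.atf n φ) Γ) (insert (α, Form.atf n ψ) Δ) h →
      Deriv c T Γ (insert (α, Form.atf n (Form.imp φ ψ)) Δ) (h+1)
  | impL {T : Finset Label} {Γ Δ : Finset LForm} {h₁ h₂ : ℕ} (α : Label) (n : ℕ) (φ ψ : Form) :
      Deriv c T Γ (insert (α, Form.atf n φ) Δ) h₁ →
      Deriv c T (insert (α, Form.atf n ψ) Γ) Δ h₂ →
      Deriv c T (insert (α, Form.atf n (Form.imp φ ψ)) Γ) Δ (max h₁ h₂ + 1)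
  | atR {T : Finset Label} {Γ Δ : Finset LForm} {h : ℕ} (α : Label) (n m : ℕ) (φ : Form) :
      Deriv c T Γ (insert (α, Form.atf m φ) Δ) h →
      Deriv c T Γ (insert (α, Form.atf n (Form.atf m φ)) Δ) (h+1)
  | atL {T : Finset Label} {Γ Δ : Finset LForm} {h : ℕ} (α : Label) (n m : ℕ) (φ : Form) :
      Deriv c T (insert (α, Form.atf m φ) Γ) Δ h →
      Deriv c T (insert (α, Form.atf n (Form.atf m φ)) Γ) Δ (h+1)
  | frR {T : Finset Label} {Γ Δ : Finset LForm} {h : ℕ} (α : Label) (n m : ℕ) (φ : Form) :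
      FreshNom m T Γ (insert (α, Form.atf n (Form.fr φ)) Δ) →
      Deriv c T (insert (α, Form.atf n (Form.diaF (Form.nom m))) Γ)
        (insert (α, Form.atf m φ) Δ) h →
      Deriv c T Γ (insert (α, Form.atf n (Form.fr φ)) Δ) (h+1)
  | frL {T : Finset Label} {Γ Δ : Finset LForm} {h₁ h₂ : ℕ} (α : Label) (n m : ℕ) (φ : Form) :
      Deriv c T Γ (insert (α, Form.atf n (Form.diaF (Form.nom m))) Δ) h₁ →
      Deriv c T (insert (α, Form.atf m φ) Γ) Δ h₂ →
      Deriv c T (insert (α, Form.atf n (Form.fr φ)) Γ) Δ (max h₁ h₂ + 1)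
  | boxR {T : Finset Label} {Γ Δ : Finset LForm} {h : ℕ} (α : Label) (n i : ℕ) (φ : Form) :
      FreshNat i T Γ (insert (α, Form.atf n (Form.box φ)) Δ) →
      Deriv c (insert (Label.child α n i) T) Γ
        (insert (Label.child α n i, Form.atf n φ) Δ) h →
      Deriv c T Γ (insert (α, Form.atf n (Form.box φ)) Δ) (h+1)
  | boxL {T : Finset Label} {Γ Δ : Finset LForm} {h : ℕ} (α : Label) (n i : ℕ) (φ : Form) :
      Label.child α n i ∈ T →
      Deriv c T (insert (Label.child α n i, Form.atf n φ) Γ) Δ h →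
      Deriv c T (insert (α, Form.atf n (Form.box φ)) Γ) Δ (h+1)
  | wlab {T : Finset Label} {Γ Δ : Finset LForm} {h : ℕ} (α : Label) :
      IsTree (insert α T) →
      Deriv c T Γ Δ h →
      Deriv c (insert α T) Γ Δ (h+1)
  | cut {T : Finset Label} {Γ Δ P S : Finset LForm} {h₁ h₂ : ℕ} (α : Label) (n : ℕ) (φ : Form) :
      c = true → α ∈ T →
      Deriv c T Γ (insert (α, Form.atf n φ) Δ) h₁ →
      Deriv c T (insert (α, Form.atf n φ) P) S h₂ →
      Deriv c T (Γ ∪ P) (Δ ∪ S) (max h₁ h₂ + 1)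

/-- Provability of a finite tree sequent (`true` = TEFL, `false` = TEFL⁻). -/
def Provable (c : Bool) (T : Finset Label) (Γ Δ : Finset LForm) : Prop :=
  ∃ h : ℕ, Deriv c T Γ Δ h

/-- Provability of a possibly infinite tree sequent in TEFL⁻ :
    some finite subsequent over a finite subtree is provable. -/
def InfProvable (T : Set Label) (Γ Δ : Set LForm) : Prop :=
  ∃ (T' : Finset Label) (Γ' Δ' : Finset LForm),
    ↑T' ⊆ T ∧ IsTree T' ∧ ↑Γ' ⊆ Γ ∧ ↑Δ' ⊆ Δ ∧ Provable false T' Γ' Δ'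

/-- Saturation conditions for a possibly infinite tree sequent. -/
structure Saturated (T : Set Label) (Γ Δ : Set LForm) : Prop where
  rep1 : ∀ (α : Label) (n m k : ℕ) (φ : Form),
    (α, Form.atf n (Form.nom m)) ∈ Γ → (α, Form.sub n k φ) ∈ Γ → (α, Form.sub m k φ) ∈ Γ
  rep2 : ∀ (α : Label) (n m k : ℕ) (φ : Form),
    (α, Form.atf m (Form.nom n)) ∈ Γ → (α, Form.sub n k φ) ∈ Γ → (α, Form.sub m k φ) ∈ Γ
  refl : ∀ α ∈ T, ∀ n : ℕ, (α, Form.atf n (Form.nom n)) ∈ Γ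
  rigid : ∀ (α β : Label) (n m : ℕ), β ∈ T →
    (α, Form.atf n (Form.nom m)) ∈ Γ → (β, Form.atf n (Form.nom m)) ∈ Γ
  impR : ∀ (α : Label) (n : ℕ) (φ ψ : Form), (α, Form.atf n (Form.imp φ ψ)) ∈ Δ →
    (α, Form.atf n φ) ∈ Γ ∧ (α, Form.atf n ψ) ∈ Δ
  impL : ∀ (α : Label) (n : ℕ) (φ ψ : Form), (α, Form.atf n (Form.imp φ ψ)) ∈ Γ →
    (α, Form.atf n φ) ∈ Δ ∨ (α, Form.atf n ψ) ∈ Γ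
  atR : ∀ (α : Label) (n m : ℕ) (φ : Form), (α, Form.atf n (Form.atf m φ)) ∈ Δ →
    (α, Form.atf m φ) ∈ Δ
  atL : ∀ (α : Label) (n m : ℕ) (φ : Form), (α, Form.atf n (Form.atf m φ)) ∈ Γ →
    (α, Form.atf m φ) ∈ Γ
  frR : ∀ (α : Label) (n : ℕ) (φ : Form), (α, Form.atf n (Form.fr φ)) ∈ Δ →
    ∃ m : ℕ, (α, Form.atf n (Form.diaF (Form.nom m))) ∈ Γ ∧ (α, Form.atf m φ) ∈ Δ
  frL : ∀ (α : Label) (n : ℕ) (φ : Form), (α, Form.atf n (Form.fr φ)) ∈ Γ →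
    ∀ m : ℕ, (α, Form.atf n (Form.diaF (Form.nom m))) ∈ Δ ∨ (α, Form.atf m φ) ∈ Γ
  boxR : ∀ (α : Label) (n : ℕ) (φ : Form), (α, Form.atf n (Form.box φ)) ∈ Δ →
    ∃ i : ℕ, Label.child α n i ∈ T ∧ (Label.child α n i, Form.atf n φ) ∈ Δ
  boxL : ∀ (α : Label) (n : ℕ) (φ : Form), (α, Form.atf n (Form.box φ)) ∈ Γ →
    ∀ i : ℕ, Label.child α n i ∈ T → (Label.child α n i, Form.atf n φ) ∈ Γ

/-- n ~ m iff α:@ₙm ∈ Γ for some α ∈ T. -/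
def nrel (T : Set Label) (Γ : Set LForm) (n m : ℕ) : Prop :=
  ∃ α ∈ T, (α, Form.atf n (Form.nom m)) ∈ Γ

/-- Propositional tautology (instance): true under every boolean valuation
    respecting ⊥ and →. -/
def IsTaut (φ : Form) : Prop :=
  ∀ v : Form → Bool, v Form.bot = false →
    (∀ ψ χ : Form, v (Form.imp ψ χ) = (!(v ψ) || v χ)) → v φ = true

/-- Uniform substitution: propositional variables by formulas, nominals by nominals. -/
def ApplySub (σp : ℕ → Form) (σn : ℕ → ℕ) : Form → Form
  | .nom n => .nom (σn n)
  | .pv p => σp p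
  | .bot => .bot
  | .imp φ ψ => .imp (ApplySub σp σn φ) (ApplySub σp σn ψ)
  | .atf n φ => .atf (σn n) (ApplySub σp σn φ)
  | .fr φ => .fr (ApplySub σp σn φ)
  | .box φ => .box (ApplySub σp σn φ)

/-- Necessity forms L ::= # | ψ→L | @ₙ□L. -/
inductive NForm : Type
  | hole : NForm
  | imp : Form → NForm → NForm
  | atBox : ℕ → NForm → NForm

/-- L(χ): replace the unique occurrence of # in L by χ. -/
def NForm.fill : NForm → Form → Form
  | .hole, χ => χ
  | .imp ψ L, χ => Form.imp ψ (NForm.fill L χ)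
  | .atBox n L, χ => Form.atf n (Form.box (NForm.fill L χ))

/-- The Hilbert system HEFL, extended by an extra set `ax` of axioms
    (HEFL itself is `Hil ∅`). -/
inductive Hil (ax : Set Form) : Form → Prop
  | extra {φ : Form} : φ ∈ ax → Hil ax φ
  | taut {φ : Form} : IsTaut φ → Hil ax φ
  | kBox (p q : ℕ) : Hil ax (Form.imp (Form.box (Form.imp (Form.pv p) (Form.pv q)))
      (Form.imp (Form.box (Form.pv p)) (Form.box (Form.pv q))))
  | kF (p q : ℕ) : Hil ax (Form.imp (Form.fr (Form.imp (Form.pv p) (Form.pv q)))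
      (Form.imp (Form.fr (Form.pv p)) (Form.fr (Form.pv q))))
  | kAt (n p q : ℕ) : Hil ax (Form.imp (Form.atf n (Form.imp (Form.pv p) (Form.pv q)))
      (Form.imp (Form.atf n (Form.pv p)) (Form.atf n (Form.pv q))))
  | refAx (n : ℕ) : Hil ax (Form.atf n (Form.nom n))
  | selfdual (n p : ℕ) : Hil ax (Form.iff (Form.neg (Form.atf n (Form.pv p)))
      (Form.atf n (Form.neg (Form.pv p))))
  | elim (n p : ℕ) : Hil ax (Form.imp (Form.atf n (Form.pv p))
      (Form.imp (Form.nom n) (Form.pv p)))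
  | agree (n m p : ℕ) : Hil ax (Form.imp (Form.atf n (Form.atf m (Form.pv p)))
      (Form.atf m (Form.pv p)))
  | back (n p : ℕ) : Hil ax (Form.imp (Form.atf n (Form.pv p))
      (Form.fr (Form.atf n (Form.pv p))))
  | dcom (n p : ℕ) : Hil ax (Form.iff (Form.atf n (Form.box (Form.atf n (Form.pv p))))
      (Form.atf n (Form.box (Form.pv p))))
  | rigidEq (n m : ℕ) : Hil ax (Form.imp (Form.atf n (Form.nom m))
      (Form.box (Form.atf n (Form.nom m))))
  | rigidNeq (n m : ℕ) : Hil ax (Form.imp (Form.neg (Form.atf n (Form.nom m)))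
      (Form.box (Form.neg (Form.atf n (Form.nom m)))))
  | mp {φ ψ : Form} : Hil ax (Form.imp φ ψ) → Hil ax φ → Hil ax ψ
  | necBox {φ : Form} : Hil ax φ → Hil ax (Form.box φ)
  | necF {φ : Form} : Hil ax φ → Hil ax (Form.fr φ)
  | necAt {φ : Form} (n : ℕ) : Hil ax φ → Hil ax (Form.atf n φ)
  | us {φ : Form} (σp : ℕ → Form) (σn : ℕ → ℕ) : Hil ax φ → Hil ax (ApplySub σp σn φ)
  | name {φ : Form} (n : ℕ) : n ∉ Form.noms φ →
      Hil ax (Form.imp (Form.nom n) φ) → Hil ax φ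
  | lbg {φ : Form} (L : NForm) (n m : ℕ) :
      m ∉ Form.noms (NForm.fill L (Form.atf n (Form.fr φ))) →
      Hil ax (NForm.fill L (Form.imp (Form.atf n (Form.diaF (Form.nom m))) (Form.atf m φ))) →
      Hil ax (NForm.fill L (Form.atf n (Form.fr φ)))

/-- finite conjunction (empty = ⊤) -/
def conjList : List Form → Form
  | [] => Form.top
  | φ :: l => Form.and φ (conjList l)

/-- finite disjunction (empty = ⊥) -/
def disjList : List Form → Form
  | [] => Form.bot
  | φ :: l => Form.or φ (disjList l)

/-- Formulaic translation, with a fuel parameter bounding the recursion depth. -/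
noncomputable def translAux : ℕ → Finset Label → Finset LForm → Finset LForm → Label → Form
  | 0, _, _, _, _ => Form.bot
  | d+1, T, Γ, Δ, α =>
    Form.imp (conjList ((Γ.filter (fun l => l.1 = α)).toList.map Prod.snd))
      (disjList (((Δ.filter (fun l => l.1 = α)).toList.map Prod.snd) ++
        (T.toList.filterMap (fun β =>
          match β with
          | Label.child γ n i =>
            if γ = α then
              some (Form.atf n (Form.box (translAux d T Γ Δ (Label.child γ n i))))
            else none
          | Label.root _ => none))))

/-- ⟦Γ ⇒ᵀ Δ⟧_α : the formulaic translation of a tree sequent at label α. -/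
noncomputable def transl (T : Finset Label) (Γ Δ : Finset LForm) (α : Label) : Form :=
  translAux (T.card + 1) T Γ Δ α

section FrameValidity
variable {W A : Type}

/-- A formula is valid in a frame: true under every valuation at every pair. -/
def FrameValid (F : Frame W A) (φ : Form) : Prop :=
  ∀ (Vp : ℕ → W → A → Prop) (Vn : ℕ → A) (w : W) (a : A),
    Sat { toFrame := F, Vp := Vp, Vn := Vn } w a φ

end FrameValidity

/-- Formulas of the shape @ₙm or @ₙ⟨F⟩m. -/
def IsRho (φ : Form) : Prop :=
  (∃ n m : ℕ, φ = Form.atf n (Form.nom m)) ∨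
    (∃ n m : ℕ, φ = Form.atf n (Form.diaF (Form.nom m)))

/-- Regular implications (ρ₁ ∧ … ∧ ρ_h) → (ρ₁' ∨ … ∨ ρ_l'). -/
def IsRegImp (φ : Form) : Prop :=
  ∃ l₁ l₂ : List Form, (∀ ρ ∈ l₁, IsRho ρ) ∧ (∀ ρ ∈ l₂, IsRho ρ) ∧
    φ = Form.imp (conjList l₁) (disjList l₂)

/-- S4 := {□p→p, □p→□□p}. -/
def S4Ax : Set Form :=
  {Form.imp (Form.box (Form.pv 0)) (Form.pv 0),
   Form.imp (Form.box (Form.pv 0)) (Form.box (Form.box (Form.pv 0)))}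

/-- S5 := S4 ∪ {p→□¬□¬p}. -/
def S5Ax : Set Form :=
  S4Ax ∪ {Form.imp (Form.pv 0)
    (Form.box (Form.neg (Form.box (Form.neg (Form.pv 0)))))}

/-- A truth-value assignment to all formulas that respects `⊥` and `→`. -/
structure BoolVal (v : Form → Prop) : Prop where
  bot : ¬ v Form.bot
  imp : ∀ a b, v (Form.imp a b) ↔ (v a → v b)

namespace BoolVal
variable {v : Form → Prop}

theorem neg (hv : BoolVal v) (a : Form) : v a.neg ↔ ¬ v a := by
  have := hv.bot
  simp only [Form.neg, hv.imp]; tauto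

theorem and (hv : BoolVal v) (a b : Form) : v (a.and b) ↔ v a ∧ v b := by
  simp only [Form.and, hv.neg, hv.imp]; tauto

theorem or (hv : BoolVal v) (a b : Form) : v (a.or b) ↔ v a ∨ v b := by
  simp only [Form.or, hv.neg, hv.imp]; tauto

theorem iff (hv : BoolVal v) (a b : Form) : v (a.iff b) ↔ (v a ↔ v b) := by
  simp only [Form.iff, hv.and, hv.imp]; tauto

theorem of_conjList (hv : BoolVal v) {φ : Form} {l : List Form} (h : φ ∈ l)
    (hl : v (conjList l)) : v φ := by
  induction l with
  | nil => simp at h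
  | cons a l ih =>
    simp only [conjList, hv.and] at hl
    rcases List.mem_cons.1 h with rfl | h
    · exact hl.1
    · exact ih h hl.2

theorem disjList_of_mem (hv : BoolVal v) {φ : Form} {l : List Form} (h : φ ∈ l) (hφ : v φ) :
    v (disjList l) := by
  induction l with
  | nil => simp at h
  | cons a l ih =>
    simp only [disjList, hv.or]
    rcases List.mem_cons.1 h with rfl | h
    · exact Or.inl hφ
    · exact Or.inr (ih h)

end BoolVal

namespace Hil
variable {ax : Set Form} {a b c d e : Form}

/-! Propositional consequence. -/

theorem prop0 (t : ∀ v, BoolVal v → v a) : Hil ax a := by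
  refine Hil.taut fun v h0 h => t (fun φ => v φ = true) ⟨by simp [h0], fun a b => ?_⟩
  rw [h]
  cases v a <;> simp

theorem prop1 (h : Hil ax a) (t : ∀ v, BoolVal v → v a → v b) : Hil ax b :=
  .mp (prop0 fun v hv => (hv.imp _ _).2 (t v hv)) h

theorem prop2 (h : Hil ax a) (h' : Hil ax b) (t : ∀ v, BoolVal v → v a → v b → v c) :
    Hil ax c :=
  .mp (prop1 h fun v hv ha => (hv.imp _ _).2 (t v hv ha)) h'

theorem prop3 (h : Hil ax a) (h' : Hil ax b) (h'' : Hil ax c)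
    (t : ∀ v, BoolVal v → v a → v b → v c → v d) : Hil ax d :=
  .mp (prop2 h h' fun v hv ha hb => (hv.imp _ _).2 (t v hv ha hb)) h''

theorem trans (h : Hil ax (a.imp b)) (h' : Hil ax (b.imp c)) : Hil ax (a.imp c) :=
  prop2 h h' fun v hv => by simp only [hv.imp]; tauto

/-! Instances of the axioms for arbitrary formulas. -/

/-- The substitution sending the variable `0` to `a` and all others to `b`. -/
def pairSub (a b : Form) : ℕ → Form
  | 0 => a
  | _ => b

theorem box_K (a b : Form) : Hil ax ((a.imp b).box.imp (a.box.imp b.box)) :=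
  Hil.us (pairSub a b) id (Hil.kBox 0 1)

theorem fr_K (a b : Form) : Hil ax ((a.imp b).fr.imp (a.fr.imp b.fr)) :=
  Hil.us (pairSub a b) id (Hil.kF 0 1)

theorem atf_K (n : ℕ) (a b : Form) :
    Hil ax ((Form.atf n (a.imp b)).imp ((Form.atf n a).imp (Form.atf n b))) :=
  Hil.us (pairSub a b) id (Hil.kAt n 0 1)

theorem atf_neg (n : ℕ) (a : Form) :
    Hil ax ((Form.atf n a).neg.iff (Form.atf n a.neg)) :=
  Hil.us (pairSub a a) id (Hil.selfdual n 0)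

theorem atf_elim (n : ℕ) (a : Form) : Hil ax ((Form.atf n a).imp ((Form.nom n).imp a)) :=
  Hil.us (pairSub a a) id (Hil.elim n 0)

theorem atf_agree (n m : ℕ) (a : Form) :
    Hil ax ((Form.atf n (Form.atf m a)).imp (Form.atf m a)) :=
  Hil.us (pairSub a a) id (Hil.agree n m 0)

theorem atf_back (n : ℕ) (a : Form) : Hil ax ((Form.atf n a).imp (Form.atf n a).fr) :=
  Hil.us (pairSub a a) id (Hil.back n 0)

theorem atf_box_atf (n : ℕ) (a : Form) :
    Hil ax ((Form.atf n (Form.atf n a).box).iff (Form.atf n a.box)) :=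
  Hil.us (pairSub a a) id (Hil.dcom n 0)

/-! Derived rules and theorems. -/

theorem box_mono (h : Hil ax (a.imp b)) : Hil ax (a.box.imp b.box) :=
  .mp (box_K a b) (.necBox h)

theorem fr_mono (h : Hil ax (a.imp b)) : Hil ax (a.fr.imp b.fr) :=
  .mp (fr_K a b) (.necF h)

theorem atf_mono (n : ℕ) (h : Hil ax (a.imp b)) :
    Hil ax ((Form.atf n a).imp (Form.atf n b)) :=
  .mp (atf_K n a b) (.necAt n h)

theorem atf_box_mono (n : ℕ) (h : Hil ax (a.imp b)) :
    Hil ax ((Form.atf n a.box).imp (Form.atf n b.box)) :=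
  atf_mono n (box_mono h)

theorem atf_box_K (n : ℕ) (a b : Form) :
    Hil ax ((Form.atf n (a.imp b).box).imp ((Form.atf n a.box).imp (Form.atf n b.box))) :=
  trans (atf_mono n (box_K a b)) (atf_K n _ _)

theorem not_atf_bot (n : ℕ) : Hil ax (Form.atf n Form.bot).neg := by
  have h : Hil ax (Form.atf n Form.bot.neg) :=
    .necAt n (prop0 fun v hv => by simp only [hv.neg]; exact hv.bot)
  exact prop2 (atf_neg n Form.bot) h fun v hv => by simp only [hv.iff]; tauto

theorem atf_intro (n m : ℕ) (a : Form) :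
    Hil ax ((Form.atf m a).imp (Form.atf n (Form.atf m a))) := by
  have h : Hil ax ((Form.atf n (Form.atf m a).neg).imp (Form.atf n (Form.atf m a.neg))) :=
    atf_mono n (prop1 (atf_neg m a) fun v hv => by simp only [hv.iff, hv.imp]; tauto)
  have h' := trans h (atf_agree n m a.neg)
  exact prop3 h' (atf_neg m a) (atf_neg (ax := ax) n (Form.atf m a)) fun v hv => by
    simp only [hv.iff, hv.imp, hv.neg]; tauto

theorem atf_replace (n m : ℕ) (a : Form) :
    Hil ax ((Form.atf n (Form.nom m)).imp ((Form.atf n a).imp (Form.atf m a))) := by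
  have h := trans (atf_mono n (atf_elim (ax := ax) m a.neg)) (atf_K n _ _)
  have h' := trans (atf_intro n m a.neg) h
  exact prop3 h' (atf_neg m a) (atf_neg (ax := ax) n a) fun v hv => by
    simp only [hv.iff, hv.imp, hv.neg]; tauto

theorem atf_nom_symm (n m : ℕ) :
    Hil ax ((Form.atf n (Form.nom m)).imp (Form.atf m (Form.nom n))) :=
  prop2 (atf_replace n m (Form.nom n)) (Hil.refAx n) fun v hv => by
    simp only [hv.imp]; tauto

theorem atf_imp_iff (n : ℕ) (a b : Form) :
    Hil ax ((Form.atf n (a.imp b)).iff ((Form.atf n a).imp (Form.atf n b))) := by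
  have h₁ : Hil ax ((Form.atf n b).imp (Form.atf n (a.imp b))) :=
    atf_mono n (prop0 fun v hv => by simp only [hv.imp]; tauto)
  have h₂ : Hil ax ((Form.atf n a.neg).imp (Form.atf n (a.imp b))) :=
    atf_mono n (prop0 fun v hv => by simp only [hv.imp, hv.neg]; tauto)
  have h₃ := prop2 h₂ (atf_neg n a) (c := (Form.atf n a).or (Form.atf n (a.imp b)))
    fun v hv => by simp only [hv.imp, hv.iff, hv.neg, hv.or]; tauto
  exact prop3 h₁ h₃ (atf_K n a b) fun v hv => by
    simp only [hv.imp, hv.iff, hv.or]; tauto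

theorem fr_bridge (n m : ℕ) (a : Form) :
    Hil ax ((Form.atf n a.fr).imp
      ((Form.atf n (Form.diaF (Form.nom m))).imp (Form.atf m a))) := by
  have h₁ : Hil ax ((Form.atf m a.neg).imp (a.imp (Form.nom m).neg)) :=
    prop1 (atf_elim m a.neg) fun v hv => by simp only [hv.imp, hv.neg]; tauto
  have h₂ := trans (trans (atf_back m a.neg) (fr_mono h₁)) (fr_K _ _)
  have h₃ := trans (trans (atf_intro n m a.neg) (atf_mono n h₂)) (atf_K n _ _)
  have h₄ : Hil ax ((Form.atf n (Form.nom m).neg.fr).neg.iff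
      (Form.atf n (Form.diaF (Form.nom m)))) := atf_neg n _
  exact prop3 h₃ h₄ (atf_neg m a) fun v hv => by
    simp only [hv.imp, hv.iff, hv.neg]; tauto

theorem not_nom_atf_box (k n m : ℕ) :
    Hil ax ((Form.atf n (Form.nom m)).neg.imp
      (Form.atf k (Form.atf n (Form.nom m)).neg.box)) := by
  have h₁ := atf_intro (ax := ax) k n (Form.nom m).neg
  have h₂ : Hil ax ((Form.atf k (Form.atf n (Form.nom m).neg)).imp
      (Form.atf k (Form.atf n (Form.nom m)).neg.box)) :=
    atf_mono k (trans (prop1 (atf_neg n (Form.nom m)) fun v hv => by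
      simp only [hv.imp, hv.iff, hv.neg]; tauto) (Hil.rigidNeq n m))
  exact prop2 (trans h₁ h₂) (atf_neg n (Form.nom m)) fun v hv => by
    simp only [hv.imp, hv.iff, hv.neg]; tauto

theorem nom_atf_box (k n m : ℕ) :
    Hil ax ((Form.atf n (Form.nom m)).imp
      (Form.atf k (Form.atf n (Form.nom m)).box)) :=
  trans (atf_intro k n _) (atf_mono k (Hil.rigidEq n m))

/-- Equal agents are interchangeable in every formula. -/
theorem replace (n m : ℕ) (τ τ' : ℕ → ℕ) (hτ : ∀ x, τ x = τ' x ∨ τ x = n ∧ τ' x = m)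
    (φ : Form) :
    Hil ax ((Form.atf n (Form.nom m)).imp
      ((ApplySub Form.pv τ φ).iff (ApplySub Form.pv τ' φ))) := by
  have lift : ∀ (g : Form → Form) (ψ χ : Form),
      (∀ {a b}, Hil ax (a.imp b) → Hil ax ((g a).imp (g b))) →
      (∀ a b, Hil ax ((g (a.imp b)).imp ((g a).imp (g b)))) →
      Hil ax ((Form.atf n (Form.nom m)).imp (g (Form.atf n (Form.nom m)))) →
      Hil ax ((Form.atf n (Form.nom m)).imp (ψ.iff χ)) →
      Hil ax ((Form.atf n (Form.nom m)).imp ((g ψ).iff (g χ))) := by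
    intro g ψ χ hm hK hb ih
    have h₁ := trans (trans hb (hm (prop1 ih (b := (Form.atf n (Form.nom m)).imp (ψ.imp χ))
      fun v hv => by simp only [hv.imp, hv.iff]; tauto))) (hK _ _)
    have h₂ := trans (trans hb (hm (prop1 ih (b := (Form.atf n (Form.nom m)).imp (χ.imp ψ))
      fun v hv => by simp only [hv.imp, hv.iff]; tauto))) (hK _ _)
    exact prop2 h₁ h₂ fun v hv => by simp only [hv.imp, hv.iff]; tauto
  induction φ with
  | nom x =>
    simp only [ApplySub]
    rcases hτ x with h | ⟨h, h'⟩
    · rw [h]; exact prop0 fun v hv => by simp only [hv.imp, hv.iff]; tauto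
    · rw [h, h']
      exact prop3 (atf_elim n (Form.nom m)) (atf_elim m (Form.nom n)) (atf_nom_symm n m)
        fun v hv => by simp only [hv.imp, hv.iff]; tauto
  | pv p => exact prop0 fun v hv => by simp only [hv.imp, hv.iff]; tauto
  | bot => exact prop0 fun v hv => by simp only [hv.imp, hv.iff]; tauto
  | imp φ ψ ih₁ ih₂ =>
    exact prop2 ih₁ ih₂ fun v hv => by simp only [ApplySub, hv.imp, hv.iff]; tauto
  | atf k φ ih =>
    simp only [ApplySub]
    have h₁ := lift (Form.atf (τ k)) _ _ (atf_mono _) (atf_K _) (atf_intro _ _ _) ih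
    rcases hτ k with h | ⟨h, h'⟩
    · rwa [← h]
    · rw [h] at h₁ ⊢
      rw [h']
      have h₂ := trans (atf_nom_symm n m) (atf_replace (ax := ax) m n (ApplySub Form.pv τ' φ))
      exact prop3 h₁ h₂ (atf_replace n m (ApplySub Form.pv τ' φ))
        fun v hv => by simp only [hv.imp, hv.iff]; tauto
  | fr φ ih => exact lift Form.fr _ _ fr_mono fr_K (atf_back _ _) ih
  | box φ ih => exact lift Form.box _ _ box_mono box_K (Hil.rigidEq _ _) ih

end Hil

/-! Renaming of nominals. -/

theorem ApplySub_sub (σ : ℕ → ℕ) (m k : ℕ) (φ : Form) :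
    ApplySub Form.pv σ (Form.sub m k φ) =
      ApplySub Form.pv (fun x => if x = k then σ m else σ x) φ := by
  induction φ with
  | nom x => simp only [Form.sub, ApplySub]; split <;> rfl
  | atf x φ ih => simp only [Form.sub, ApplySub, ih, Form.atf.injEq, and_true]; split <;> rfl
  | _ => simp_all [Form.sub, ApplySub]

theorem ApplySub_update (σ : ℕ → ℕ) (m k : ℕ) (φ : Form) (h : m ∉ Form.noms φ) :
    ApplySub Form.pv (Function.update σ m k) φ = ApplySub Form.pv σ φ := by
  induction φ with
  | nom x => simp_all [Form.noms, ApplySub, eq_comm]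
  | atf x φ ih =>
    simp only [Form.noms, Finset.mem_insert, not_or] at h
    simp [ApplySub, ih h.2, Function.update_of_ne (Ne.symm h.1)]
  | _ => simp_all [Form.noms, ApplySub]

theorem ApplySub_id (φ : Form) : ApplySub Form.pv id φ = φ := by
  induction φ <;> simp_all [ApplySub]

/-! Necessity forms. -/

namespace NForm
variable {ax : Set Form}

/-- Substitute a necessity form for the placeholder of another. -/
def comp : NForm → NForm → NForm
  | hole, K => K
  | imp ψ L, K => imp ψ (comp L K)
  | atBox n L, K => atBox n (comp L K)

theorem fill_comp (L K : NForm) (χ : Form) : (L.comp K).fill χ = L.fill (K.fill χ) := by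
  induction L <;> simp_all [comp, fill]

theorem fill_nec (L : NForm) {χ : Form} (h : Hil ax χ) : Hil ax (L.fill χ) := by
  induction L with
  | hole => exact h
  | imp ψ L ih => exact Hil.prop1 ih fun v hv => by simp only [fill, hv.imp]; tauto
  | atBox n L ih => exact .necAt n (.necBox ih)

theorem fill_K (L : NForm) (a b : Form) :
    Hil ax ((L.fill (a.imp b)).imp ((L.fill a).imp (L.fill b))) := by
  induction L with
  | hole => exact Hil.prop0 fun v hv => by simp only [fill, hv.imp]; tauto
  | imp ψ L ih => exact Hil.prop1 ih fun v hv => by simp only [fill, hv.imp]; tauto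
  | atBox n L ih =>
    exact Hil.trans (Hil.atf_box_mono n ih) (Hil.atf_box_K n _ _)

theorem fill_mono (L : NForm) {a b : Form} (h : Hil ax (a.imp b)) :
    Hil ax ((L.fill a).imp (L.fill b)) :=
  .mp (L.fill_K a b) (L.fill_nec h)

theorem iff_fill (L : NForm) {a b c : Form} (h : Hil ax (c.iff (L.fill a)))
    (hab : ∀ v, BoolVal v → (v a ↔ v b)) : Hil ax (c.iff (L.fill b)) := by
  have h₁ : Hil ax (a.imp b) := Hil.prop0 fun v hv => (hv.imp _ _).2 (hab v hv).1
  have h₂ : Hil ax (b.imp a) := Hil.prop0 fun v hv => (hv.imp _ _).2 (hab v hv).2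
  exact Hil.prop3 h (L.fill_mono h₁) (L.fill_mono h₂) fun v hv => by
    simp only [hv.imp, hv.iff]; tauto

end NForm

/-! Trees presented as lists of edges, each list extending its tail by one new leaf. -/

/-- An edge `(parent, nominal, child)`. -/
abbrev LEdge : Type := Label × ℕ × Label

/-- The nodes of the tree with root `r` and edges `es`. -/
def IsNode (r : Label) (es : List LEdge) (x : Label) : Prop :=
  x = r ∨ ∃ e ∈ es, e.2.2 = x

/-- Every edge attaches a new leaf to a node of the tree formed by the later edges. -/
def WFEdges (r : Label) : List LEdge → Prop
  | [] => True
  | e :: es => IsNode r es e.1 ∧ ¬ IsNode r es e.2.2 ∧ WFEdges r es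

/-- Absorb a leaf, labelled by `S`, into its parent. -/
def absorb (e : LEdge) (S : Label → Form) : Label → Form :=
  Function.update S e.1
    ((S e.1).and (Form.atf e.2.1 (Form.box (S e.2.2).neg)).neg)

/-- The formula saying that the tree whose nodes are labelled by `S` cannot be realised. -/
def refute (r : Label) : List LEdge → (Label → Form) → Form
  | [], S => (S r).neg
  | e :: es, S => refute r es (absorb e S)

section Refute
variable {ax : Set Form} {r : Label}

theorem IsNode.cons {es : List LEdge} {x : Label} (e : LEdge) (h : IsNode r es x) :
    IsNode r (e :: es) x := by
  rcases h with h | ⟨e', he', h⟩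
  · exact Or.inl h
  · exact Or.inr ⟨e', List.mem_cons_of_mem _ he', h⟩

theorem isNode_cons {es : List LEdge} {x : Label} {e : LEdge} :
    IsNode r (e :: es) x ↔ x = e.2.2 ∨ IsNode r es x := by
  simp only [IsNode, List.mem_cons, exists_eq_or_imp, eq_comm (a := x)]; tauto

theorem absorb_imp (e : LEdge) (S : Label → Form) (x : Label) :
    Hil ax ((absorb e S x).imp (S x)) := by
  unfold absorb
  by_cases h : x = e.1
  · subst h
    rw [Function.update_self]
    exact Hil.prop0 fun v hv => by simp only [hv.imp, hv.and]; tauto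
  · rw [Function.update_of_ne h]
    exact Hil.prop0 fun v hv => by simp only [hv.imp]; tauto

theorem absorb_parent_imp (e : LEdge) (S : Label → Form) {φ : Form}
    (h : Hil ax ((S e.2.2).imp φ)) :
    Hil ax ((absorb e S e.1).imp (Form.atf e.2.1 (Form.box φ.neg)).neg) := by
  have h' : Hil ax (φ.neg.imp (S e.2.2).neg) :=
    Hil.prop1 h fun v hv => by simp only [hv.imp, hv.neg]; tauto
  simp only [absorb, Function.update_self]
  exact Hil.prop1 (Hil.atf_box_mono e.2.1 h') fun v hv => by
    simp only [hv.imp, hv.neg, hv.and]; tauto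

theorem refute_antitone {es : List LEdge} {S S' : Label → Form}
    (h : ∀ x, IsNode r es x → Hil ax ((S x).imp (S' x))) :
    Hil ax ((refute r es S').imp (refute r es S)) := by
  induction es generalizing S S' with
  | nil =>
    exact Hil.prop1 (h r (Or.inl rfl)) fun v hv => by
      simp only [refute, hv.imp, hv.neg]; tauto
  | cons e es ih =>
    refine ih fun x hn => ?_
    by_cases hx : x = e.1
    · subst hx
      have h₁ := absorb_parent_imp e S (h e.2.2 (isNode_cons.2 (Or.inl rfl)))
      have h₂ := absorb_imp (ax := ax) e S e.1
      refine Hil.prop3 h₁ h₂ (h e.1 (hn.cons e)) fun v hv => ?_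
      rw [show absorb e S' e.1 = _ from Function.update_self ..]
      simp only [hv.imp, hv.neg, hv.and]; tauto
    · simpa only [absorb, Function.update_of_ne hx] using h x (hn.cons e)

theorem refute_congr {es : List LEdge} {S S' : Label → Form}
    (h : ∀ x, IsNode r es x → S x = S' x) : refute r es S = refute r es S' := by
  induction es generalizing S S' with
  | nil => simp only [refute, h r (Or.inl rfl)]
  | cons e es ih =>
    refine ih fun x hx => ?_
    by_cases hxe : x = e.1
    · subst hxe
      simp only [absorb, Function.update_self, h _ (hx.cons e),
        h _ (isNode_cons.2 (Or.inl rfl))]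
    · simpa only [absorb, Function.update_of_ne hxe] using h x (hx.cons e)

/-- The label of a node occurs, negated, inside a necessity form. -/
theorem exists_nform {es : List LEdge} (hes : WFEdges r es) (S : Label → Form) {x : Label}
    (hx : IsNode r es x) :
    ∃ L : NForm,
      (∀ θ, Hil ax ((refute r es (Function.update S x θ)).iff (L.fill θ.neg))) ∧
      ∀ m, (∀ y, IsNode r es y → m ∉ (S y).noms) → (∀ e ∈ es, m ≠ e.2.1) →
        ∀ χ, m ∉ χ.noms → m ∉ (L.fill χ).noms := by
  induction es generalizing S x with
  | nil =>
    obtain rfl : x = r := by simpa [IsNode] using hx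
    refine ⟨.hole, fun θ => ?_, fun m _ _ χ h => h⟩
    simp only [refute, Function.update_self, NForm.fill]
    exact Hil.prop0 fun v hv => by simp only [hv.iff]
  | cons e es ih =>
    obtain ⟨hp, hc, hes⟩ := hes
    have hne : e.2.2 ≠ e.1 := fun h => hc (h ▸ hp)
    have hnp : IsNode r (e :: es) e.1 := hp.cons e
    have hnc : IsNode r (e :: es) e.2.2 := isNode_cons.2 (Or.inl rfl)
    by_cases hxp : x = e.1
    · subst hxp
      obtain ⟨L, hL, hm⟩ := ih hes S hp
      refine ⟨L.comp (.imp (Form.atf e.2.1 (Form.box (S e.2.2).neg)).neg .hole),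
        fun θ => ?_, fun m h₁ h₂ χ h₃ => ?_⟩
      · have := hL (θ.and (Form.atf e.2.1 (Form.box (S e.2.2).neg)).neg)
        simp only [refute, absorb, Function.update_self, Function.update_of_ne hne,
          Function.update_idem, NForm.fill_comp, NForm.fill]
        exact L.iff_fill this fun v hv => by simp only [hv.neg, hv.and, hv.imp]; tauto
      · rw [NForm.fill_comp]
        refine hm m (fun y hy => h₁ y (hy.cons e))
          (fun e' he' => h₂ e' (List.mem_cons_of_mem _ he')) _ ?_
        have := h₁ _ hnc
        have := h₂ e (by simp)
        simp_all [NForm.fill, Form.noms, Form.neg]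
    · by_cases hxc : x = e.2.2
      · subst hxc
        obtain ⟨L, hL, hm⟩ := ih hes S hp
        refine ⟨L.comp (.imp (S e.1) (.atBox e.2.1 .hole)),
          fun θ => ?_, fun m h₁ h₂ χ h₃ => ?_⟩
        · have h₁ := hL ((S e.1).and (Form.atf e.2.1 (Form.box θ.neg)).neg)
          have h₂ : refute r es (Function.update (Function.update S e.2.2 θ) e.1
              ((S e.1).and (Form.atf e.2.1 (Form.box θ.neg)).neg)) = refute r es
              (Function.update S e.1 ((S e.1).and (Form.atf e.2.1 (Form.box θ.neg)).neg)) := by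
            refine refute_congr fun y hy => ?_
            have hyx : y ≠ e.2.2 := fun h => hc (h ▸ hy)
            simp only [Function.update_apply, if_neg hyx]
          simp only [refute, absorb, Function.update_self,
            Function.update_of_ne (Ne.symm hxp),
            NForm.fill_comp, NForm.fill]
          rw [h₂]
          exact L.iff_fill h₁ fun v hv => by simp only [hv.neg, hv.and, hv.imp]; tauto
        · rw [NForm.fill_comp]
          refine hm m (fun y hy => h₁ y (hy.cons e))
            (fun e' he' => h₂ e' (List.mem_cons_of_mem _ he')) _ ?_
          have := h₁ _ hnp
          have := h₂ e (by simp)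
          simp_all [NForm.fill, Form.noms]
      · have hx' : IsNode r es x := (isNode_cons.1 hx).resolve_left hxc
        obtain ⟨L, hL, hm⟩ := ih hes (absorb e S) hx'
        refine ⟨L, fun θ => ?_, fun m h₁ h₂ χ h₃ => ?_⟩
        · have h := hL θ
          simp only [refute]
          rwa [show absorb e (Function.update S x θ) = Function.update (absorb e S) x θ from ?_]
          simp only [absorb, Function.update_of_ne (Ne.symm hxp),
            Function.update_of_ne (Ne.symm hxc)]
          exact Function.update_comm hxp _ _ _
        · refine hm m (fun y hy => ?_)
            (fun e' he' => h₂ e' (List.mem_cons_of_mem _ he')) _ h₃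
          by_cases hy' : y = e.1
          · subst hy'
            have := h₁ _ hnp
            have := h₁ _ hnc
            have := h₂ e (by simp)
            simp_all [absorb, Form.noms, Form.neg, Form.and]
          · simpa only [absorb, Function.update_of_ne hy'] using h₁ y (hy.cons e)

theorem update_and_imp (S : Label → Form) (x : Label) (ψ : Form) (y : Label) :
    Hil ax ((Function.update S x ((S x).and ψ) y).imp (S y)) := by
  by_cases h : y = x
  · subst h
    rw [Function.update_self]
    exact Hil.prop0 fun v hv => by simp only [hv.imp, hv.and]; tauto
  · rw [Function.update_of_ne h]
    exact Hil.prop0 fun v hv => by simp only [hv.imp]; tauto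

variable {es : List LEdge} {S : Label → Form}

theorem refute_of_split (hes : WFEdges r es) {x : Label} (hx : IsNode r es x) (ψ : Form)
    (h₁ : Hil ax (refute r es (Function.update S x ((S x).and ψ))))
    (h₂ : Hil ax (refute r es (Function.update S x ((S x).and ψ.neg)))) :
    Hil ax (refute r es S) := by
  obtain ⟨L, hL, -⟩ := exists_nform (ax := ax) hes S hx
  have h₃ : Hil ax (L.fill ((S x).and ψ).neg) :=
    Hil.prop2 h₁ (hL _) fun v hv => by simp only [hv.iff]; tauto
  have h₄ : Hil ax (L.fill ((S x).and ψ.neg).neg) :=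
    Hil.prop2 h₂ (hL _) fun v hv => by simp only [hv.iff]; tauto
  have h₅ := hL (S x)
  rw [Function.update_eq_self] at h₅
  have h₆ : Hil ax (((S x).and ψ).neg.imp (((S x).and ψ.neg).neg.imp (S x).neg)) :=
    Hil.prop0 fun v hv => by simp only [hv.imp, hv.neg, hv.and]; tauto
  have h₇ := Hil.mp (Hil.mp (L.fill_K _ _) (Hil.mp (L.fill_mono h₆) h₃)) h₄
  exact Hil.prop2 h₇ h₅ fun v hv => by simp only [hv.iff]; tauto

theorem refute_of_not (hes : WFEdges r es) {x : Label} (hx : IsNode r es x)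
    (h : Hil ax (S x).neg) : Hil ax (refute r es S) := by
  obtain ⟨L, hL, -⟩ := exists_nform (ax := ax) hes S hx
  have h' := hL (S x)
  rw [Function.update_eq_self] at h'
  exact Hil.prop2 (L.fill_nec h) h' fun v hv => by simp only [hv.iff]; tauto

theorem exists_node_absorb {e : LEdge} (he : IsNode r es e.1) {x : Label}
    (hx : IsNode r (e :: es) x) {ψ : Form} (h : Hil ax ((S x).imp ψ))
    (hψ : ∀ k, Hil ax (ψ.neg.imp (Form.atf k ψ.neg.box))) :
    ∃ y, IsNode r es y ∧ Hil ax ((absorb e S y).imp ψ) := by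
  rcases isNode_cons.1 hx with rfl | hx
  · exact ⟨e.1, he, Hil.prop2 (absorb_parent_imp e S h) (hψ e.2.1) fun v hv => by
      simp only [hv.imp, hv.neg]; tauto⟩
  · exact ⟨x, hx, Hil.trans (absorb_imp e S x) h⟩

/-- Identities between agents cannot vary within a tree. -/
theorem refute_of_nom (hes : WFEdges r es) {x y : Label} (hx : IsNode r es x)
    (hy : IsNode r es y) {n m : ℕ} (h : Hil ax ((S x).imp (Form.atf n (Form.nom m))))
    (h' : Hil ax ((S y).imp (Form.atf n (Form.nom m)).neg)) : Hil ax (refute r es S) := by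
  induction es generalizing S x y with
  | nil =>
    simp only [IsNode, List.not_mem_nil, false_and, exists_false, or_false] at hx hy
    subst hx; subst hy
    exact Hil.prop2 h h' fun v hv => by simp only [refute, hv.imp, hv.neg]; tauto
  | cons e es ih =>
    obtain ⟨x', hx', h₁⟩ := exists_node_absorb hes.1 hx h fun k => Hil.not_nom_atf_box k n m
    obtain ⟨y', hy', h₂⟩ := exists_node_absorb hes.1 hy h' fun k => by
      have h₃ : Hil ax ((Form.atf n (Form.nom m)).imp (Form.atf n (Form.nom m)).neg.neg) :=
        Hil.prop0 fun v hv => by simp only [hv.imp, hv.neg]; tauto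
      exact Hil.prop2 (Hil.nom_atf_box k n m) (Hil.atf_box_mono k h₃) fun v hv => by
        simp only [hv.imp, hv.neg]; tauto
    exact ih hes.2.2 hx' hy' h₁ h₂

theorem refute_of_box (hes : WFEdges r es) {p c : Label} {n : ℕ} (he : (p, n, c) ∈ es)
    {φ : Form} (h : Hil ax ((S p).imp (Form.atf n φ.box)))
    (h' : Hil ax ((S c).imp φ.neg)) : Hil ax (refute r es S) := by
  induction es generalizing S with
  | nil => simp at he
  | cons e es ih =>
    rcases List.mem_cons.1 he with rfl | he
    · refine refute_of_not (es := es) hes.2.2 hes.1 ?_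
      have h₁ : Hil ax (φ.imp φ.neg.neg) :=
        Hil.prop0 fun v hv => by simp only [hv.imp, hv.neg]; tauto
      have h₂ := Hil.trans (absorb_imp (ax := ax) (p, n, c) S p) h
      exact Hil.prop3 (absorb_parent_imp (p, n, c) S h') (Hil.atf_box_mono n h₁) h₂
        fun v hv => by simp only [hv.imp, hv.neg]; tauto
    · exact ih hes.2.2 he (Hil.trans (absorb_imp e S p) h) (Hil.trans (absorb_imp e S c) h')

theorem refute_imp_not_root (Q : Label → Form)
    (hQ : ∀ e ∈ es, Hil ax ((Q e.1).imp (Form.atf e.2.1 (Form.box (Q e.2.2).neg)).neg))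
    (hS : ∀ x, Hil ax ((Q x).imp (S x))) :
    Hil ax ((refute r es S).imp (Q r).neg) := by
  induction es generalizing S with
  | nil => exact Hil.prop1 (hS r) fun v hv => by simp only [refute, hv.imp, hv.neg]; tauto
  | cons e es ih =>
    refine ih (fun e' he' => hQ e' (List.mem_cons_of_mem _ he')) fun x => ?_
    unfold absorb
    by_cases hx : x = e.1
    · subst hx
      rw [Function.update_self]
      have h₁ : Hil ax ((S e.2.2).neg.imp (Q e.2.2).neg) :=
        Hil.prop1 (hS e.2.2) fun v hv => by simp only [hv.imp, hv.neg]; tauto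
      exact Hil.prop3 (hS e.1) (hQ e (by simp)) (Hil.atf_box_mono e.2.1 h₁) fun v hv => by
        simp only [hv.imp, hv.neg, hv.and]; tauto
    · rw [Function.update_of_ne hx]
      exact hS x

theorem exists_nodes (r : Label) (es : List LEdge) :
    ∃ N : Finset Label, ∀ x, IsNode r es x → x ∈ N :=
  ⟨insert r (es.map fun e => e.2.2).toFinset, fun x hx => by simpa [IsNode] using hx⟩

end Refute

instance : Infinite Label :=
  Infinite.of_injective Label.root fun _ _ h => Label.root.inj h

/-- The tree with edges `es` and node labels `S` realises the tree sequent `Γ ⇒ᵀ Δ` along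
the map `f` of labels and the renaming `σ` of nominals. -/
structure Realizes (ax : Set Form) (r : Label) (es : List LEdge) (T : Finset Label)
    (Γ Δ : Finset LForm) (f : Label → Label) (σ : ℕ → ℕ) (S : Label → Form) : Prop where
  node : ∀ α, IsNode r es (f α)
  edge : ∀ α n i, Label.child α n i ∈ T → (f α, σ n, f (Label.child α n i)) ∈ es
  pos : ∀ α φ, (α, φ) ∈ Γ → Hil ax ((S (f α)).imp (ApplySub Form.pv σ φ))
  neg : ∀ α φ, (α, φ) ∈ Δ → Hil ax ((S (f α)).imp (ApplySub Form.pv σ φ).neg)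

namespace Realizes
variable {ax : Set Form} {r : Label} {es : List LEdge} {T : Finset Label}
  {Γ Δ : Finset LForm} {f : Label → Label} {σ : ℕ → ℕ} {S : Label → Form}

theorem mono {T' : Finset Label} {Γ' Δ' : Finset LForm}
    (I : Realizes ax r es T Γ Δ f σ S) (hT : T' ⊆ T) (hΓ : Γ' ⊆ Γ) (hΔ : Δ' ⊆ Δ) :
    Realizes ax r es T' Γ' Δ' f σ S :=
  ⟨I.node, fun α n i h => I.edge α n i (hT h), fun α φ h => I.pos α φ (hΓ h),
    fun α φ h => I.neg α φ (hΔ h)⟩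

theorem tail_left {l : LForm} (I : Realizes ax r es T (insert l Γ) Δ f σ S) :
    Realizes ax r es T Γ Δ f σ S :=
  I.mono subset_rfl (Finset.subset_insert _ _) subset_rfl

theorem tail_right {l : LForm} (I : Realizes ax r es T Γ (insert l Δ) f σ S) :
    Realizes ax r es T Γ Δ f σ S :=
  I.mono subset_rfl subset_rfl (Finset.subset_insert _ _)

theorem strengthen {S' : Label → Form} (I : Realizes ax r es T Γ Δ f σ S)
    (h : ∀ x, Hil ax ((S' x).imp (S x))) : Realizes ax r es T Γ Δ f σ S' :=
  ⟨I.node, I.edge, fun α φ hφ => Hil.trans (h _) (I.pos α φ hφ),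
    fun α φ hφ => Hil.trans (h _) (I.neg α φ hφ)⟩

theorem insert_left (I : Realizes ax r es T Γ Δ f σ S) {α : Label} {φ : Form}
    (h : Hil ax ((S (f α)).imp (ApplySub Form.pv σ φ))) :
    Realizes ax r es T (insert (α, φ) Γ) Δ f σ S := by
  refine ⟨I.node, I.edge, fun β ψ hψ => ?_, I.neg⟩
  rcases Finset.mem_insert.1 hψ with hψ | hψ
  · cases hψ; exact h
  · exact I.pos β ψ hψ

theorem insert_right (I : Realizes ax r es T Γ Δ f σ S) {α : Label} {φ : Form}
    (h : Hil ax ((S (f α)).imp (ApplySub Form.pv σ φ).neg)) :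
    Realizes ax r es T Γ (insert (α, φ) Δ) f σ S := by
  refine ⟨I.node, I.edge, I.pos, fun β ψ hψ => ?_⟩
  rcases Finset.mem_insert.1 hψ with hψ | hψ
  · cases hψ; exact h
  · exact I.neg β ψ hψ

theorem assume_left (I : Realizes ax r es T Γ Δ f σ S) (α : Label) (φ : Form) :
    Realizes ax r es T (insert (α, φ) Γ) Δ f σ
      (Function.update S (f α) ((S (f α)).and (ApplySub Form.pv σ φ))) :=
  (I.strengthen (update_and_imp S _ _)).insert_left <| by
    rw [Function.update_self]
    exact Hil.prop0 fun v hv => by simp only [hv.imp, hv.and]; tauto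

theorem assume_right (I : Realizes ax r es T Γ Δ f σ S) (α : Label) (φ : Form) :
    Realizes ax r es T Γ (insert (α, φ) Δ) f σ
      (Function.update S (f α) ((S (f α)).and (ApplySub Form.pv σ φ).neg)) :=
  (I.strengthen (update_and_imp S _ _)).insert_right <| by
    rw [Function.update_self]
    exact Hil.prop0 fun v hv => by simp only [hv.imp, hv.and]; tauto

theorem rename (I : Realizes ax r es T Γ Δ f σ S) {m : ℕ} (hm : FreshNom m T Γ Δ) (k : ℕ) :
    Realizes ax r es T Γ Δ f (Function.update σ m k) S := by
  refine ⟨I.node, fun α n i h => ?_, fun α φ h => ?_, fun α φ h => ?_⟩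
  · have hn : n ≠ m := fun hn => hm.1 _ h (by simp [Label.noms, hn])
    rw [Function.update_of_ne hn]
    exact I.edge α n i h
  · rw [ApplySub_update _ _ _ _ (hm.2.1 _ h).2]
    exact I.pos α φ h
  · rw [ApplySub_update _ _ _ _ (hm.2.2 _ h).2]
    exact I.neg α φ h

/-- Extend a realisation by a new leaf. -/
theorem add_leaf (I : Realizes ax r es T Γ Δ f σ S) {α : Label} {n i : ℕ}
    (hi : FreshNat i T Γ Δ) (hα : i ∉ α.nats) {y : Label} (hy : ¬ IsNode r es y) (ψ : Form) :
    Realizes ax r ((f α, σ n, y) :: es) (insert (Label.child α n i) T) Γ Δ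
      (Function.update f (Label.child α n i) y) σ (Function.update S y ψ) := by
  have hf : ∀ β, β ≠ Label.child α n i →
      Function.update f (Label.child α n i) y β = f β :=
    fun β hβ => Function.update_of_ne hβ _ _
  have hS : ∀ β, Function.update S y ψ (f β) = S (f β) := fun β =>
    Function.update_of_ne (fun h : f β = y => hy (h ▸ I.node β)) _ _
  have hne : ∀ β, i ∉ Label.nats β → β ≠ Label.child α n i := by
    rintro β hβ rfl
    simp [Label.nats] at hβ
  refine ⟨fun β => ?_, fun β k i' h => ?_, fun β φ h => ?_, fun β φ h => ?_⟩
  · by_cases hβ : β = Label.child α n i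
    · subst hβ
      exact isNode_cons.2 (Or.inl (Function.update_self ..))
    · rw [hf β hβ]
      exact (I.node β).cons _
  · rcases Finset.mem_insert.1 h with h | h
    · cases h
      rw [Function.update_self, hf α (hne α hα)]
      simp
    · have h₁ := hi.1 _ h
      have h₂ : i ∉ Label.nats β := fun h' => h₁ (by simp [Label.nats, h'])
      rw [hf _ (hne _ h₁), hf _ (hne _ h₂)]
      exact List.mem_cons_of_mem _ (I.edge β k i' h)
  · rw [hf _ (hne _ (hi.2.1 _ h)), hS]
    exact I.pos β φ h
  · rw [hf _ (hne _ (hi.2.2 _ h)), hS]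
    exact I.neg β φ h

end Realizes

/-- A realisation of a provable tree sequent is refutable. -/
theorem Deriv.refute {ax : Set Form} {r : Label} {c : Bool} {T : Finset Label}
    {Γ Δ : Finset LForm} {h : ℕ} (d : Deriv c T Γ Δ h) {es : List LEdge}
    {f : Label → Label} {σ : ℕ → ℕ} {S : Label → Form} (hes : WFEdges r es)
    (I : Realizes ax r es T Γ Δ f σ S) : Hil ax (refute r es S) := by
  induction d generalizing es f σ S with
  | bot α n =>
    exact refute_of_not hes (I.node α) (Hil.prop2 (I.pos α _ (Finset.mem_insert_self _ _))
      (Hil.not_atf_bot (σ n)) fun v hv => by simp only [ApplySub, hv.imp, hv.neg]; tauto)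
  | id α n φ =>
    exact refute_of_not hes (I.node α) (Hil.prop2 (I.pos α _ (Finset.mem_insert_self _ _))
      (I.neg α _ (Finset.mem_insert_self _ _)) fun v hv => by
        simp only [hv.imp, hv.neg]; tauto)
  | rep1 α n m k φ _ ih =>
    have h₁ := I.pos α _ (Finset.mem_insert_self _ _)
    have h₂ := I.pos α _ (Finset.mem_insert_of_mem (Finset.mem_insert_self _ _))
    refine ih hes ((I.tail_left.tail_left.insert_left ?_).insert_left h₁)
    rw [ApplySub_sub] at h₂ ⊢
    exact Hil.prop3 h₁ h₂ (Hil.replace (σ n) (σ m) (fun x => if x = k then σ n else σ x)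
      (fun x => if x = k then σ m else σ x) (fun x => by split <;> simp) φ) fun v hv => by
        simp only [ApplySub, hv.imp, hv.iff]; tauto
  | rep2 α n m k φ _ ih =>
    have h₁ := I.pos α _ (Finset.mem_insert_self _ _)
    have h₂ := I.pos α _ (Finset.mem_insert_of_mem (Finset.mem_insert_self _ _))
    refine ih hes ((I.tail_left.tail_left.insert_left ?_).insert_left h₁)
    rw [ApplySub_sub] at h₂ ⊢
    exact Hil.prop3 h₁ h₂ (Hil.replace (σ n) (σ m) (fun x => if x = k then σ n else σ x)
      (fun x => if x = k then σ m else σ x) (fun x => by split <;> simp) φ) fun v hv => by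
        simp only [ApplySub, hv.imp, hv.iff]; tauto
  | refl α n _ _ ih =>
    exact ih hes (I.insert_left (Hil.prop1 (Hil.refAx (σ n)) fun v hv => by
      simp only [ApplySub, hv.imp]; tauto))
  | rigid α β n m _ _ ih =>
    have h₁ := I.pos α _ (Finset.mem_insert_self _ _)
    refine refute_of_split hes (I.node β) _
      (ih hes (I.tail_left.assume_left β (Form.atf n (Form.nom m)))) ?_
    refine refute_of_nom hes (I.node α) (I.node β)
      (Hil.trans (update_and_imp S _ _ _) h₁) ?_
    rw [Function.update_self]
    exact Hil.prop0 fun v hv => by simp only [ApplySub, hv.imp, hv.and]; tauto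
  | impR α n φ ψ _ ih =>
    have h₁ := I.neg α _ (Finset.mem_insert_self _ _)
    have h₂ := Hil.atf_imp_iff (ax := ax) (σ n) (ApplySub Form.pv σ φ) (ApplySub Form.pv σ ψ)
    refine ih hes ((I.tail_right.insert_left ?_).insert_right ?_) <;>
    exact Hil.prop2 h₁ h₂ fun v hv => by
      simp only [ApplySub, hv.imp, hv.iff, hv.neg]; tauto
  | impL α n φ ψ _ _ ih₁ ih₂ =>
    have h₁ := I.pos α _ (Finset.mem_insert_self _ _)
    have h₂ := Hil.atf_imp_iff (ax := ax) (σ n) (ApplySub Form.pv σ φ) (ApplySub Form.pv σ ψ)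
    refine refute_of_split hes (I.node α) _
      (ih₂ hes (I.tail_left.assume_left α (Form.atf n ψ)))
      (ih₁ hes ((I.tail_left.strengthen (update_and_imp S _ _)).insert_right ?_))
    rw [Function.update_self]
    exact Hil.prop2 h₁ h₂ fun v hv => by
      simp only [ApplySub, hv.imp, hv.iff, hv.neg, hv.and]; tauto
  | atR α n m φ _ ih =>
    have h₁ := I.neg α _ (Finset.mem_insert_self _ _)
    exact ih hes (I.tail_right.insert_right (Hil.prop2 h₁
      (Hil.atf_intro (σ n) (σ m) (ApplySub Form.pv σ φ)) fun v hv => by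
        simp only [ApplySub, hv.imp, hv.neg]; tauto))
  | atL α n m φ _ ih =>
    exact ih hes (I.tail_left.insert_left (Hil.trans
      (I.pos α _ (Finset.mem_insert_self _ _)) (Hil.atf_agree _ _ _)))
  | frR α n m φ hm _ ih =>
    have h₁ := I.neg α _ (Finset.mem_insert_self _ _)
    obtain ⟨N, hN⟩ := exists_nodes r es
    obtain ⟨k, hk⟩ := Infinite.exists_notMem_finset
      (N.biUnion (fun y => (S y).noms) ∪ (es.map fun e => e.2.1).toFinset ∪
        (Form.atf (σ n) (ApplySub Form.pv σ φ)).noms)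
    simp only [Finset.mem_union, Finset.mem_biUnion, not_or, not_exists, not_and,
      List.mem_toFinset, List.mem_map] at hk
    obtain ⟨⟨hkS, hke⟩, hkφ⟩ := hk
    have hmφ := (hm.2.2 _ (Finset.mem_insert_self _ _)).2
    simp only [Form.noms, Finset.mem_insert, not_or] at hmφ
    have hσn : Function.update σ m k n = σ n := Function.update_of_ne (Ne.symm hmφ.1) _ _
    have hσm : Function.update σ m k m = k := Function.update_self ..
    have hσφ := ApplySub_update σ m k φ hmφ.2
    have I' := ((I.rename hm k).tail_right.assume_left α
      (Form.atf n (Form.diaF (Form.nom m)))).assume_right α (Form.atf m φ)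
    have h₂ := ih hes I'
    rw [Function.update_self, Function.update_idem] at h₂
    simp only [ApplySub, Form.diaF, Form.neg, hσn, hσm, hσφ] at h₂
    obtain ⟨L, hL, hLm⟩ := exists_nform (ax := ax) hes S (I.node α)
    have h₃ : Hil ax ((L.comp (.imp (S (f α)) .hole)).fill
        ((Form.atf (σ n) (Form.diaF (Form.nom k))).imp
          (Form.atf k (ApplySub Form.pv σ φ)))) := by
      rw [NForm.fill_comp]
      refine Hil.prop2 h₂ (L.iff_fill (hL _) fun v hv => ?_) fun v hv ha hb => ((hv.iff _ _).1 hb).1 ha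
      simp only [NForm.fill, Form.diaF, Form.neg, hv.imp, hv.and]
      have := hv.bot
      tauto
    have h₄ := Hil.lbg _ (σ n) k (by
      rw [NForm.fill_comp]
      refine hLm k (fun y hy => hkS y (hN y hy)) (fun e he h => hke e he h.symm) _ ?_
      have := hkS _ (hN _ (I.node α))
      simp_all [NForm.fill, Form.noms]) h₃
    rw [NForm.fill_comp] at h₄
    have h₅ := hL (S (f α))
    rw [Function.update_eq_self] at h₅
    have h₆ : Hil ax (((NForm.imp (S (f α)) .hole).fill
        (Form.atf (σ n) (ApplySub Form.pv σ φ).fr)).imp (S (f α)).neg) :=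
      Hil.prop1 h₁ fun v hv => by simp only [NForm.fill, ApplySub, hv.imp, hv.neg]; tauto
    exact Hil.prop3 h₄ (L.fill_mono h₆) h₅ fun v hv => by simp only [hv.imp, hv.iff]; tauto
  | frL α n m φ _ _ ih₁ ih₂ =>
    have h₁ := I.pos α _ (Finset.mem_insert_self _ _)
    have h₂ := Hil.fr_bridge (ax := ax) (σ n) (σ m) (ApplySub Form.pv σ φ)
    refine refute_of_split hes (I.node α) _
      (ih₂ hes (I.tail_left.assume_left α (Form.atf m φ)))
      (ih₁ hes ((I.tail_left.strengthen (update_and_imp S _ _)).insert_right ?_))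
    rw [Function.update_self]
    exact Hil.prop2 h₁ h₂ fun v hv => by
      simp only [ApplySub, Form.diaF, Form.neg, hv.imp, hv.and]; tauto
  | @boxR T Γ Δ _ α n i φ hi _ ih =>
    have h₁ := I.neg α _ (Finset.mem_insert_self _ _)
    obtain ⟨N, hN⟩ := exists_nodes r es
    obtain ⟨y, hy⟩ := Infinite.exists_notMem_finset N
    have hy : ¬ IsNode r es y := fun h => hy (hN y h)
    have hα : i ∉ Label.nats α := hi.2.2 _ (Finset.mem_insert_self _ _)
    have I' := (I.add_leaf (n := n) hi hα hy
      (Form.atf (σ n) (ApplySub Form.pv σ φ)).neg).tail_right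
    have h₂ := ih (es := (f α, σ n, y) :: es) ⟨I.node α, hy, hes⟩ (I'.insert_right (by
      rw [Function.update_self, Function.update_self]
      exact Hil.prop0 fun v hv => by simp only [ApplySub, hv.imp, hv.neg]; tauto))
    refine .mp (refute_antitone fun x hx => ?_) h₂
    have hxy : x ≠ y := fun h => hy (h ▸ hx)
    by_cases hxα : x = f α
    · subst hxα
      have h₃ : Hil ax ((Form.atf (σ n) (ApplySub Form.pv σ φ)).neg.neg.imp
          (Form.atf (σ n) (ApplySub Form.pv σ φ))) :=
        Hil.prop0 fun v hv => by simp only [hv.imp, hv.neg]; tauto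
      simp only [absorb, Function.update_self, Function.update_of_ne hxy]
      exact Hil.prop3 h₁ (Hil.atf_box_mono (σ n) h₃)
        (Hil.atf_box_atf (σ n) (ApplySub Form.pv σ φ)) fun v hv => by
          simp only [ApplySub, hv.imp, hv.iff, hv.neg, hv.and]; tauto
    · simp only [absorb, Function.update_of_ne hxα, Function.update_of_ne hxy]
      exact Hil.prop0 fun v hv => by simp only [hv.imp]; tauto
  | boxL α n i φ hT _ ih =>
    have h₁ := I.pos α _ (Finset.mem_insert_self _ _)
    refine refute_of_split hes (I.node (Label.child α n i)) _
      (ih hes (I.tail_left.assume_left (Label.child α n i) (Form.atf n φ))) ?_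
    refine refute_of_box hes (I.edge α n i hT)
      (φ := Form.atf (σ n) (ApplySub Form.pv σ φ)) ?_ ?_
    · exact Hil.prop3 (update_and_imp S _ _ _) h₁
        (Hil.atf_box_atf (σ n) (ApplySub Form.pv σ φ)) fun v hv => by
          simp only [ApplySub, hv.imp, hv.iff]; tauto
    · rw [Function.update_self]
      exact Hil.prop0 fun v hv => by simp only [ApplySub, hv.imp, hv.and]; tauto
  | wlab α _ _ ih =>
    exact ih hes (I.mono (Finset.subset_insert _ _) subset_rfl subset_rfl)
  | cut α n φ _ _ _ _ ih₁ ih₂ =>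
    refine refute_of_split hes (I.node α) _
      (ih₂ hes ((I.mono subset_rfl Finset.subset_union_right
        Finset.subset_union_right).assume_left α (Form.atf n φ)))
      (ih₁ hes ((I.mono subset_rfl Finset.subset_union_left
        Finset.subset_union_left).assume_right α (Form.atf n φ)))

/-! The formulaic translation. -/

/-- The distance of a label from its root. -/
def Label.depth : Label → ℕ
  | .root _ => 0
  | .child α _ _ => Label.depth α + 1

theorem Label.depth_lt_card {T : Finset Label}
    (hT : ∀ α n i, Label.child α n i ∈ T → α ∈ T) {α : Label} (hα : α ∈ T) :
    α.depth < T.card := by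
  have h : ∀ α ∈ T, ∀ k ≤ α.depth, ∃ β ∈ T, β.depth = k := by
    intro α
    induction α with
    | root j => exact fun hα k hk => ⟨_, hα, (Nat.le_zero.1 hk).symm⟩
    | child α n i ih =>
      intro hα k hk
      rcases Nat.lt_or_eq_of_le hk with hk | rfl
      · exact ih (hT _ _ _ hα) k (Nat.lt_succ_iff.1 hk)
      · exact ⟨_, hα, rfl⟩
  have h' : Finset.range (α.depth + 1) ⊆ T.image Label.depth := fun k hk =>
    Finset.mem_image.2 (h α hα k (Nat.lt_succ_iff.1 (Finset.mem_range.1 hk)))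
  simpa using (Finset.card_le_card h').trans Finset.card_image_le

/-- The edges of a finite tree of labels can be listed leaf by leaf. -/
theorem exists_edges (j : ℕ) (T : Finset Label)
    (hT : ∀ α n i, Label.child α n i ∈ T → α = Label.root j ∨ α ∈ T)
    (hj : ∀ k, Label.root k ∈ T → k = j) :
    ∃ es : List LEdge, WFEdges (Label.root j) es ∧
      (∀ x, IsNode (Label.root j) es x ↔ x = Label.root j ∨ x ∈ T) ∧
      (∀ α n i, Label.child α n i ∈ T → (α, n, Label.child α n i) ∈ es) ∧
      ∀ e ∈ es, ∃ i, e.2.2 = Label.child e.1 e.2.1 i := by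
  induction T using Finset.induction_on_max_value Label.depth with
  | empty => exact ⟨[], trivial, by simp [IsNode], by simp, by simp⟩
  | insert a s ha hmax ih =>
    obtain ⟨es, hes, hn, he, hc⟩ := ih
      (fun α n i h => by
        rcases hT α n i (Finset.mem_insert_of_mem h) with h' | h'
        · exact Or.inl h'
        · rcases Finset.mem_insert.1 h' with rfl | h'
          · have := hmax _ h
            simp [Label.depth] at this
          · exact Or.inr h')
      fun k hk => hj k (Finset.mem_insert_of_mem hk)
    cases a with
    | root k =>
      obtain rfl := hj k (Finset.mem_insert_self _ _)
      exact ⟨es, hes, fun x => by rw [hn, Finset.mem_insert]; tauto,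
        fun α n i h => he α n i (by simpa using h), hc⟩
    | child α n i =>
      refine ⟨(α, n, Label.child α n i) :: es, ⟨(hn α).2 ?_, ?_, hes⟩, fun x => ?_,
        fun β k i' h => ?_, fun e h => ?_⟩
      · rcases hT α n i (Finset.mem_insert_self _ _) with h | h
        · exact Or.inl h
        · rcases Finset.mem_insert.1 h with h | h
          · have := congrArg Label.depth h
            simp [Label.depth] at this
          · exact Or.inr h
      · simpa [hn] using ha
      · rw [isNode_cons, hn, Finset.mem_insert]; tauto
      · rcases Finset.mem_insert.1 h with h | h
        · cases h; simp
        · exact List.mem_cons_of_mem _ (he β k i' h)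
      · rcases List.mem_cons.1 h with rfl | h
        · exact ⟨i, rfl⟩
        · exact hc e h

section Translation
variable {ax : Set Form} {T : Finset Label} {Γ Δ : Finset LForm} {d : ℕ}

theorem translAux_neg_imp_left {α : Label} {φ : Form} (h : (α, φ) ∈ Γ) :
    Hil ax ((translAux (d + 1) T Γ Δ α).neg.imp φ) := by
  refine Hil.prop0 fun v hv => ?_
  rw [translAux, hv.imp, hv.neg, hv.imp, Classical.not_imp]
  refine fun h' => hv.of_conjList ?_ h'.1
  simpa using h

theorem translAux_neg_imp_right {α : Label} {φ : Form} (h : (α, φ) ∈ Δ) :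
    Hil ax ((translAux (d + 1) T Γ Δ α).neg.imp φ.neg) := by
  refine Hil.prop0 fun v hv => ?_
  rw [translAux, hv.imp, hv.neg, hv.neg, hv.imp, Classical.not_imp]
  refine fun h' hφ => h'.2 (hv.disjList_of_mem (List.mem_append_left _ ?_) hφ)
  simpa using h

theorem translAux_neg_imp_child {α : Label} {n i : ℕ} (h : Label.child α n i ∈ T) :
    Hil ax ((translAux (d + 1) T Γ Δ α).neg.imp
      (Form.atf n (Form.box (translAux d T Γ Δ (Label.child α n i)).neg.neg)).neg) := by
  have h₁ : Hil ax ((translAux d T Γ Δ (Label.child α n i)).neg.neg.imp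
      (translAux d T Γ Δ (Label.child α n i))) :=
    Hil.prop0 fun v hv => by simp only [hv.imp, hv.neg]; tauto
  refine Hil.prop1 (Hil.atf_box_mono n h₁) fun v hv => ?_
  rw [translAux]
  simp only [hv.imp, hv.neg, Classical.not_imp]
  refine fun h₂ h₃ h₄ => h₃.2 (hv.disjList_of_mem (List.mem_append_right _ ?_) (h₂ h₄))
  rw [List.mem_filterMap]
  exact ⟨_, Finset.mem_toList.2 h, by simp⟩

end Translation

/-- if a tree sequent is provable in TEFL then its formulaic
    translation at the root of T is provable in HEFL. -/
theorem TEFL_to_HEFL (T : Finset Label) (Γ Δ : Finset LForm) (j : ℕ)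
    (hT : IsTree T) (hroot : Label.root j ∈ T)
    (hΓ : ∀ l ∈ Γ, l.1 ∈ T) (hΔ : ∀ l ∈ Δ, l.1 ∈ T)
    (hprov : Provable true T Γ Δ) :
    Hil ∅ (transl T Γ Δ (Label.root j)) := by
  obtain ⟨h, d⟩ := hprov
  obtain ⟨es, hes, hn, he, hc⟩ := exists_edges j T (fun α n i hα => Or.inr (hT.2 α n i hα))
    fun k hk => hT.1.unique hk hroot
  have hn' : ∀ x, IsNode (Label.root j) es x ↔ x ∈ T := fun x => by
    rw [hn, or_iff_right_of_imp]
    rintro rfl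
    exact hroot
  let Q : Label → Form := fun α => (translAux (T.card + 1 - α.depth) T Γ Δ α).neg
  have hQ : ∀ α ∈ T, ∃ k, T.card - α.depth = k ∧ Q α = (translAux (k + 1) T Γ Δ α).neg :=
    fun α hα => ⟨_, rfl, by
      have := Label.depth_lt_card hT.2 hα
      simp only [Q, Nat.succ_sub this.le, Nat.succ_eq_add_one]⟩
  have hf : ∀ α ∈ T, (if α ∈ T then α else Label.root j) = α := fun α hα => if_pos hα
  have I : Realizes ∅ (Label.root j) es T Γ Δ
      (fun α => if α ∈ T then α else Label.root j) id Q := by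
    refine ⟨fun α => ?_, fun α n i hα => ?_, fun α φ hφ => ?_, fun α φ hφ => ?_⟩
    · rw [hn']
      split
      · assumption
      · exact hroot
    · simp only [hf _ hα, hf _ (hT.2 _ _ _ hα), id]
      exact he α n i hα
    · obtain ⟨k, -, hk⟩ := hQ α (hΓ _ hφ)
      simp only [hf _ (hΓ _ hφ), ApplySub_id, hk]
      exact translAux_neg_imp_left hφ
    · obtain ⟨k, -, hk⟩ := hQ α (hΔ _ hφ)
      simp only [hf _ (hΔ _ hφ), ApplySub_id, hk]
      exact translAux_neg_imp_right hφ
  refine Hil.prop2 (d.refute hes I)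
    (refute_imp_not_root (r := Label.root j) (es := es) (S := Q) Q (fun e hmem => ?_)
      fun x => Hil.prop0 fun v hv => by simp only [hv.imp]; tauto) fun v hv => ?_
  · obtain ⟨p, n, c⟩ := e
    obtain ⟨i, hi⟩ := hc _ hmem
    simp only at hi
    subst hi
    have hcT : Label.child p n i ∈ T := (hn' _).1 (Or.inr ⟨_, hmem, rfl⟩)
    obtain ⟨k, hk, hp⟩ := hQ p (hT.2 _ _ _ hcT)
    have hcQ : Q (Label.child p n i) = (translAux k T Γ Δ (Label.child p n i)).neg := by
      simp only [Q, Label.depth, Nat.add_sub_add_right, hk]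
    simp only [hp, hcQ]
    exact translAux_neg_imp_child hcT
  · simp only [Q, Label.depth, hv.imp, hv.neg, not_not, transl]
    exact fun h₁ h₂ => h₂ h₁
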